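/- arXiv:2604.11587 — 2 statements merged into one kernel-verified Lean document; each statement's English description precedes it below -/
import Mathlib

section
/- Let X be a metric space and γ : ℝ → X a continuous map with γ 0 = s and γ 1 = g whose total variation on [0,1] equals a finite value C. Then there exists t* ∈ [0,1] such that the total variation of γ on [0,t*] is at most C/2 and the total variation of γ on [t*,1] is at most C/2. Moreover, for any heuristic ĥ : X → ℝ satisfying 0 ≤ ĥ x ≤ dist(x, g) for all x ∈ X, the point x* = γ t* satisfies both 2·(variation of γ on [0,t*]) ≤ C and (variation of γ on [0,t*]) + ĥ x* ≤ C. (Existence of a meeting state at which the MM priority max(g + ĥ, 2g) does not exceed the solution cost.) -/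
/-- A continuous path whose variation on `[a, b]` is at most `c + d` can be cut at a point of
`[a, b]` into a piece of variation at most `c` followed by a piece of variation at most `d`. -/
theorem exists_eVariationOn_Icc_le_and_le {E : Type*} [PseudoEMetricSpace E] {γ : ℝ → E}
    {a b : ℝ} (hab : a ≤ b) (hγ : Continuous γ) {c d : ENNReal}
    (h : eVariationOn γ (Set.Icc a b) ≤ c + d) :
    ∃ t ∈ Set.Icc a b, eVariationOn γ (Set.Icc a t) ≤ c ∧ eVariationOn γ (Set.Icc t b) ≤ d := by
  let S : Set ℝ := {t | t ∈ Set.Icc a b ∧ eVariationOn γ (Set.Icc a t) ≤ c}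
  have haS : a ∈ S := ⟨Set.left_mem_Icc.2 hab, by simp⟩
  have hSb : BddAbove S := ⟨b, fun t ht => ht.1.2⟩
  refine ⟨sSup S, ⟨le_csSup hSb haS, csSup_le ⟨a, haS⟩ fun t ht => ht.1.2⟩, ?_, ?_⟩
  · rw [← eVariationOn.eVariationOn_Ico_eq_Icc_of_continuousWithinAt hγ.continuousWithinAt]
    by_contra! hlt
    obtain ⟨x, hx, y, hy, -, hxy⟩ := eVariationOn.exists_lt_eVariationOn_inter_Icc hlt
    obtain ⟨z, hz, hyz⟩ := exists_lt_of_lt_csSup ⟨a, haS⟩ hy.2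
    refine (hxy.trans_le (eVariationOn.mono γ ?_)).not_ge hz.2
    exact fun w hw => ⟨hw.1.1, hw.2.2.trans hyz.le⟩
  · rw [← eVariationOn.eVariationOn_Ioc_eq_Icc_of_continuousWithinAt hγ.continuousWithinAt]
    by_contra! hlt
    obtain ⟨x, hx, y, hy, -, hxy⟩ := eVariationOn.exists_lt_eVariationOn_inter_Icc hlt
    have hax : a ≤ x := (le_csSup hSb haS).trans hx.1.le
    have hd : d < eVariationOn γ (Set.Icc x b) :=
      hxy.trans_le (eVariationOn.mono γ fun w hw => ⟨hw.2.1, hw.1.2⟩)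
    have hc : c < eVariationOn γ (Set.Icc a x) := by
      by_contra! hle
      exact (le_csSup hSb ⟨⟨hax, hx.2⟩, hle⟩).not_gt hx.1
    have hadd := eVariationOn.Icc_add_Icc γ hax hx.2 (Set.mem_univ x)
    simp only [Set.univ_inter] at hadd
    exact (ENNReal.add_lt_add hc hd).not_ge (hadd ▸ h)


/-- Existence of a meeting state: on a continuous path `γ` from `s` to `g` with
finite total variation `C` on `[0,1]`, there is a parameter `t` splitting the
path into two halves of variation at most `C / 2`; moreover, for every
admissible nonnegative heuristic `h` (with `h x ≤ dist x g`), the MM priority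
of the meeting state `γ t` with cost-to-come equal to the variation of `γ` on
`[0, t]` does not exceed the solution cost `C`. -/
theorem exists_meeting_state {X : Type*} [MetricSpace X] (γ : ℝ → X) (s g : X)
    (hcont : Continuous γ) (h0 : γ 0 = s) (h1 : γ 1 = g)
    (C : ℝ) (hC0 : 0 ≤ C)
    (hC : eVariationOn γ (Set.Icc 0 1) = ENNReal.ofReal C) :
    ∃ t ∈ Set.Icc (0:ℝ) 1,
      eVariationOn γ (Set.Icc 0 t) ≤ ENNReal.ofReal (C / 2) ∧
      eVariationOn γ (Set.Icc t 1) ≤ ENNReal.ofReal (C / 2) ∧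
      ∀ h : X → ℝ, (∀ x, 0 ≤ h x ∧ h x ≤ dist x g) →
        2 * (eVariationOn γ (Set.Icc 0 t)).toReal ≤ C ∧
        (eVariationOn γ (Set.Icc 0 t)).toReal + h (γ t) ≤ C := by
  have hC2 : 0 ≤ C / 2 := by positivity
  obtain ⟨t, ht, hl, hr⟩ := exists_eVariationOn_Icc_le_and_le zero_le_one hcont
    (c := ENNReal.ofReal (C / 2)) (d := ENNReal.ofReal (C / 2))
    (by rw [hC, ← ENNReal.ofReal_add hC2 hC2, add_halves])
  refine ⟨t, ht, hl, hr, fun h hh => ?_⟩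
  have hlt := ENNReal.toReal_le_of_le_ofReal hC2 hl
  have hdist : dist (γ t) g ≤ C / 2 := by
    rw [← h1, ← ENNReal.ofReal_le_ofReal_iff hC2, ← edist_dist]
    exact (eVariationOn.edist_le γ (Set.left_mem_Icc.2 ht.2) (Set.right_mem_Icc.2 ht.2)).trans hr
  have := (hh (γ t)).2
  constructor <;> linarith
end

section
/- Let x_start, x_goal ∈ EuclideanSpace ℝ (Fin n), let d = ‖x_start − x_goal‖, let C be a real number with C ≥ d, and let m = (x_start + x_goal)/2 be the midpoint of the foci. Then the closed ball centered at m of radius √(C² − d²)/2 is contained in the informed set X(C) = {x : ‖x − x_start‖ + ‖x − x_goal‖ ≤ C}, and X(C) is contained in the closed ball centered at m of radius C/2. (These are the semi-minor and semi-major axis bounds of the prolate hyperspheroid used for informed sampling.) -/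
/-- The distance from a point to the midpoint of `a` and `b` is half the norm of the sum of the
displacements from `a` and `b`. -/
theorem dist_midpoint_eq_norm_add_div_two {E : Type*} [NormedAddCommGroup E] [NormedSpace ℝ E]
    (x a b : E) : dist x (midpoint ℝ a b) = ‖(x - a) + (x - b)‖ / 2 := by
  have h : x - midpoint ℝ a b = (2⁻¹ : ℝ) • ((x - a) + (x - b)) := by
    rw [midpoint_eq_smul_add, invOf_eq_inv]
    module
  rw [dist_eq_norm, h, norm_smul, Real.norm_of_nonneg (by norm_num)]
  ring

/-- Semi-minor and semi-major axis bounds of the prolate hyperspheroid used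
for informed sampling: with `d = ‖x_start - x_goal‖ ≤ C` and `m` the midpoint
of the foci, the closed ball about `m` of radius `√(C² - d²) / 2` is contained
in the informed set `X(C) = {x : ‖x - x_start‖ + ‖x - x_goal‖ ≤ C}`, which in
turn is contained in the closed ball about `m` of radius `C / 2`. -/
theorem informed_set_axis_bounds {n : ℕ}
    (xstart xgoal : EuclideanSpace ℝ (Fin n)) (C : ℝ)
    (hC : ‖xstart - xgoal‖ ≤ C) :
    Metric.closedBall (midpoint ℝ xstart xgoal)
        (Real.sqrt (C ^ 2 - ‖xstart - xgoal‖ ^ 2) / 2) ⊆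
      {x : EuclideanSpace ℝ (Fin n) | ‖x - xstart‖ + ‖x - xgoal‖ ≤ C} ∧
    {x : EuclideanSpace ℝ (Fin n) | ‖x - xstart‖ + ‖x - xgoal‖ ≤ C} ⊆
      Metric.closedBall (midpoint ℝ xstart xgoal) (C / 2) := by
  have hC0 : 0 ≤ C := (norm_nonneg _).trans hC
  refine ⟨fun x hx => ?_, fun x hx => ?_⟩
  · rw [Metric.mem_closedBall, dist_midpoint_eq_norm_add_div_two,
      div_le_div_iff_of_pos_right two_pos] at hx
    have hsq : ‖(x - xstart) + (x - xgoal)‖ ^ 2 ≤ C ^ 2 - ‖xstart - xgoal‖ ^ 2 := by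
      have hd : 0 ≤ C ^ 2 - ‖xstart - xgoal‖ ^ 2 :=
        sub_nonneg.2 (pow_le_pow_left₀ (norm_nonneg _) hC 2)
      exact (Real.le_sqrt (norm_nonneg _) hd).1 hx
    have hpar := parallelogram_law_with_norm ℝ (x - xstart) (x - xgoal)
    rw [sub_sub_sub_cancel_left, norm_sub_rev xgoal xstart] at hpar
    refine abs_le_of_sq_le_sq' ?_ hC0 |>.2
    linarith [add_sq_le (a := ‖x - xstart‖) (b := ‖x - xgoal‖)]
  · rw [Metric.mem_closedBall, dist_midpoint_eq_norm_add_div_two,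
      div_le_div_iff_of_pos_right two_pos]
    exact (norm_add_le _ _).trans hx
end
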